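/- arXiv:1812.06872 — 4 statements merged into one kernel-verified Lean document; each statement's English description precedes it below -/
import Mathlib

section
/- Let M be a von Neumann algebra acting on a complex Hilbert space H in which every isometry is a unitary (i.e., for V ∈ M, V*V = 1 implies VV* = 1; M is a finite von Neumann algebra). Let A₁, …, Aₙ be closed densely defined operators on H, each affiliated with M. Then the linear subspace D := D(A₁) ∩ … ∩ D(Aₙ) is a core for each Aᵢ; that is, for each i, the graph of Aᵢ equals the closure in H ⊕ H of the graph of the restriction of Aᵢ to D. -/
/-- A closed densely defined operator (given as a partially defined linear map) is
*affiliated* with a von Neumann algebra `M` if for every unitary `U` in the commutant of `M`,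
the image of its graph under `(x, y) ↦ (U x, U y)` equals its graph. -/
def VonNeumannAlgebra.Affiliated {H : Type*} [NormedAddCommGroup H]
    [InnerProductSpace ℂ H] [CompleteSpace H]
    (M : VonNeumannAlgebra H) (T : H →ₗ.[ℂ] H) : Prop :=
  ∀ U : H →L[ℂ] H, U ∈ M.commutant → star U * U = 1 → U * star U = 1 →
    (fun p : H × H => (U p.1, U p.2)) '' (T.graph : Set (H × H)) = (T.graph : Set (H × H))

namespace CoreAux

open ContinuousLinearMap

variable {H : Type*} [NormedAddCommGroup H] [InnerProductSpace ℂ H] [CompleteSpace H]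

theorem denseRange_iff (T : H →L[ℂ] H) : DenseRange T ↔ ∀ x, (star T) x = 0 → x = 0 := by
  have h1 : DenseRange T ↔ T.rangeᗮ = ⊥ := by
    rw [← Submodule.topologicalClosure_eq_top_iff, ← Submodule.dense_iff_topologicalClosure_eq_top]
    rfl
  rw [h1, ContinuousLinearMap.orthogonal_range, Submodule.eq_bot_iff]
  rfl

theorem mem_of_commute (M : VonNeumannAlgebra H) {T : H →L[ℂ] H}
    (h : ∀ y ∈ M.commutant, y * T = T * y) : T ∈ M := by
  rw [← M.commutant_commutant]
  exact VonNeumannAlgebra.mem_commutant_iff.2 h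

theorem commute_of_mem (M : VonNeumannAlgebra H) {T y : H →L[ℂ] H}
    (hT : T ∈ M) (hy : y ∈ M.commutant) : y * T = T * y :=
  (VonNeumannAlgebra.mem_commutant_iff.1 hy T hT).symm

theorem eq_of_mul_dense {a b c : H →L[ℂ] H} (hc : DenseRange c) (h : a * c = b * c) : a = b := by
  have : (a : H → H) = b := hc.equalizer a.continuous b.continuous (by
    funext z; exact congrArg (fun f : H →L[ℂ] H => f z) h)
  exact DFunLike.coe_injective this

theorem douglas (M : VonNeumannAlgebra H) {X c : H →L[ℂ] H} (hX : X ∈ M) (hc : c ∈ M)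
    (hd : DenseRange c) (hle : ∀ z, ‖X z‖ ≤ ‖c z‖) : ∃ a ∈ M, X = a * c := by
  let a : H →L[ℂ] H := (X : H →ₗ[ℂ] H).extendOfNorm (c : H →ₗ[ℂ] H)
  have ha : a * c = X := by
    ext z
    exact LinearMap.extendOfNorm_eq (f := (X : H →ₗ[ℂ] H)) (e := (c : H →ₗ[ℂ] H)) hd
      ⟨1, fun x => by simpa using hle x⟩ z
  refine ⟨a, mem_of_commute M fun y hy => ?_, ha.symm⟩
  apply eq_of_mul_dense hd
  rw [mul_assoc, ha, mul_assoc, commute_of_mem M hc hy, ← mul_assoc, ha, commute_of_mem M hX hy]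

theorem polar (M : VonNeumannAlgebra H) {X Y : H →L[ℂ] H} (hX : X ∈ M) (hY : Y ∈ M)
    (hinj : ∀ z, X z = 0 → Y z = 0 → z = 0) :
    ∃ a ∈ M, ∃ b ∈ M, ∃ c ∈ M, star c = c ∧ DenseRange c ∧ X = a * c ∧ Y = b * c ∧
      star a * a + star b * b = 1 := by
  set P : H →L[ℂ] H := star X * X + star Y * Y with hP
  have hP0 : 0 ≤ P := add_nonneg (star_mul_self_nonneg X) (star_mul_self_nonneg Y)
  have hPM : P ∈ M := add_mem (mul_mem (star_mem hX) hX) (mul_mem (star_mem hY) hY)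
  set c : H →L[ℂ] H := CFC.sqrt P with hcdef
  have hcc : c * c = P := CFC.sqrt_mul_sqrt_self P hP0
  have hcs : star c = c := (IsSelfAdjoint.of_nonneg (CFC.sqrt_nonneg P)).star_eq
  have hcM : c ∈ M := by
    apply mem_of_commute
    intro y hy
    have h1 : Commute P y := (commute_of_mem M hPM hy).symm
    have h2 : Commute c y := by
      rw [hcdef, CFC.sqrt_eq_cfc]
      exact h1.cfc_nnreal _
    exact h2.symm
  have hnorm : ∀ z, ‖c z‖ ^ 2 = ‖X z‖ ^ 2 + ‖Y z‖ ^ 2 := by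
    intro z
    have key : ∀ T : H →L[ℂ] H, inner ℂ ((star T * T) z) z = ((‖T z‖ : ℂ) ^ 2) := by
      intro T
      rw [ContinuousLinearMap.mul_apply, ContinuousLinearMap.star_eq_adjoint,
        ContinuousLinearMap.adjoint_inner_left, inner_self_eq_norm_sq_to_K]
      rfl
    have h3 := key c
    rw [hcs, hcc, hP, ContinuousLinearMap.add_apply, inner_add_left, key X, key Y] at h3
    exact_mod_cast h3.symm
  have hcinj : ∀ z, c z = 0 → z = 0 := by
    intro z hz
    have := hnorm z
    rw [hz, norm_zero] at this
    have hx : ‖X z‖ = 0 := by nlinarith [sq_nonneg ‖X z‖, sq_nonneg ‖Y z‖]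
    have hy : ‖Y z‖ = 0 := by nlinarith [sq_nonneg ‖X z‖, sq_nonneg ‖Y z‖]
    exact hinj z (norm_eq_zero.1 hx) (norm_eq_zero.1 hy)
  have hd : DenseRange c := (denseRange_iff c).2 (by rw [hcs]; exact hcinj)
  obtain ⟨a, haM, ha⟩ := douglas M hX hcM hd fun z =>
    abs_le_of_sq_le_sq' (by nlinarith [hnorm z, sq_nonneg ‖Y z‖]) (norm_nonneg _) |>.2
  obtain ⟨b, hbM, hb⟩ := douglas M hY hcM hd fun z =>
    abs_le_of_sq_le_sq' (by nlinarith [hnorm z, sq_nonneg ‖X z‖]) (norm_nonneg _) |>.2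
  refine ⟨a, haM, b, hbM, c, hcM, hcs, hd, ha, hb, ?_⟩
  apply eq_of_mul_dense hd
  have h4 : star ((star a * a + star b * b) * c) * c = star (1 * c) * c := by
    have : star ((star a * a + star b * b) * c) * c = P := by
      rw [hP, ha, hb]
      simp only [star_mul, star_add, star_star]
      noncomm_ring
    rw [this, one_mul, hcs, hcc]
  exact star_injective (eq_of_mul_dense hd h4)

section Fin

variable (M : VonNeumannAlgebra H)
    (hfin : ∀ V : H →L[ℂ] H, V ∈ M → star V * V = 1 → V * star V = 1)

include hfin in
theorem inj_star {T : H →L[ℂ] H} (hT : T ∈ M) (hinj : ∀ z, T z = 0 → z = 0) :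
    ∀ z, (star T) z = 0 → z = 0 := by
  obtain ⟨a, haM, b, hbM, c, hcM, hcs, hd, ha, hb, hab⟩ :=
    polar M hT (zero_mem M) (fun z hz _ => hinj z hz)
  have hb0 : b = 0 := eq_of_mul_dense hd (by rw [← hb, zero_mul])
  rw [hb0, mul_zero, add_zero] at hab
  have h1 := hfin a haM hab
  intro z hz
  rw [ha, star_mul, hcs] at hz
  have h2 : (star a) z = 0 := by
    have := (denseRange_iff c).1 hd
    rw [hcs] at this
    exact this _ hz
  have h3 : (a * star a) z = 0 := by
    rw [ContinuousLinearMap.mul_apply, h2, map_zero]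
  rw [h1] at h3
  exact h3

include hfin in
theorem ore {S T : H →L[ℂ] H} (hS : S ∈ M) (hT : T ∈ M) (hTd : DenseRange T) :
    ∃ R ∈ M, DenseRange R ∧ ∃ Q : H →L[ℂ] H, S * R = T * Q := by
  have hTi := (denseRange_iff T).1 hTd
  obtain ⟨a, haM, b, hbM, c, hcM, hcs, hd, ha, hb, hab⟩ :=
    polar M (star_mem hT) (star_mem hS) (fun z hz _ => hTi z hz)
  have hTc : T = c * star a := by rw [← star_star T, ha, star_mul, hcs]
  have hSc : S = c * star b := by rw [← star_star S, hb, star_mul, hcs]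
  have hT2 : ∀ z, T z = 0 → z = 0 := by
    have := inj_star M hfin (star_mem hT) hTi
    rwa [star_star] at this
  have has : ∀ z, (star a) z = 0 → z = 0 := by
    intro z hz
    apply hT2
    rw [hTc, ContinuousLinearMap.mul_apply, hz, map_zero]
  have hai : ∀ z, a z = 0 → z = 0 := by
    have := inj_star M hfin (star_mem haM) has
    rwa [star_star] at this
  have h1 : star b * b = 1 - star a * a := by rw [← hab]; abel
  refine ⟨1 - b * star b, sub_mem (one_mem M) (mul_mem hbM (star_mem hbM)), ?_,
    a * star b, ?_⟩
  · rw [denseRange_iff]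
    intro z hz
    have hz' : z = b ((star b) z) := by
      have : star (1 - b * star b) = 1 - b * star b := by simp
      rw [this] at hz
      exact sub_eq_zero.1 hz
    have h2 : (star a) (a ((star b) z)) = 0 := by
      have h3 := congrArg (fun f : H →L[ℂ] H => f ((star b) z)) h1
      simp only [ContinuousLinearMap.mul_apply, ContinuousLinearMap.sub_apply,
        ContinuousLinearMap.one_apply] at h3
      rw [← hz'] at h3
      exact sub_eq_self.1 h3.symm
    have h4 := hai _ (has _ h2)
    rw [hz', h4, map_zero]
  · rw [hTc, hSc]
    have : star b * (1 - b * star b) = star a * a * star b := by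
      rw [mul_sub, mul_one, ← mul_assoc, h1]; noncomm_ring
    rw [mul_assoc, this]; noncomm_ring

include hfin in
theorem inter {ι : Type*} [DecidableEq ι] (T : ι → (H →L[ℂ] H)) (hT : ∀ i, T i ∈ M)
    (hd : ∀ i, DenseRange (T i)) (s : Finset ι) :
    ∃ W ∈ M, DenseRange W ∧ ∀ i ∈ s, ∀ x, ∃ y, W x = T i y := by
  induction s using Finset.induction_on with
  | empty => exact ⟨1, one_mem M, fun x => subset_closure ⟨x, rfl⟩, by simp⟩
  | insert j s hj ih =>
    obtain ⟨W, hW, hWd, hWs⟩ := ih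
    obtain ⟨R, hR, hRd, Q, hQ⟩ := ore M hfin hW (hT j) (hd j)
    refine ⟨W * R, mul_mem hW hR, ?_, ?_⟩
    · exact hWd.comp hRd W.continuous
    · intro i hi x
      rcases Finset.mem_insert.1 hi with rfl | hi
      · exact ⟨Q x, congrArg (fun f : H →L[ℂ] H => f x) hQ⟩
      · exact hWs i hi (R x)

end Fin

theorem mem_of_commute_unitary (M : VonNeumannAlgebra H) {T : H →L[ℂ] H}
    (h : ∀ U ∈ M.commutant, star U * U = 1 → U * star U = 1 → U * T = T * U) : T ∈ M := by
  apply mem_of_commute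
  have hcl : IsClosed (M.commutant.toStarSubalgebra : Set (H →L[ℂ] H)) := by
    rw [VonNeumannAlgebra.coe_toStarSubalgebra, VonNeumannAlgebra.coe_commutant]
    exact Set.isClosed_centralizer _
  letI : CStarAlgebra M.commutant.toStarSubalgebra :=
    StarSubalgebra.cstarAlgebra _ (h_closed := hcl)
  intro y hy
  have hmem : (⟨y, hy⟩ : M.commutant.toStarSubalgebra) ∈
      Submodule.span ℂ (unitary M.commutant.toStarSubalgebra : Set M.commutant.toStarSubalgebra) := by
    rw [CStarAlgebra.span_unitary]; trivial
  have : ∀ w : M.commutant.toStarSubalgebra, w ∈ Submodule.span ℂ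
      (unitary M.commutant.toStarSubalgebra : Set M.commutant.toStarSubalgebra) →
      (w : H →L[ℂ] H) * T = T * w := by
    intro w hw
    induction hw using Submodule.span_induction with
    | mem u hu =>
      have h1 := hu
      refine h u u.2 ?_ ?_
      · exact congrArg Subtype.val (Unitary.star_mul_self_of_mem hu)
      · exact congrArg Subtype.val (Unitary.mul_star_self_of_mem hu)
    | zero => simp
    | add u v _ _ hu hv =>
      push_cast
      rw [add_mul, mul_add, hu, hv]
    | smul k u _ hu =>
      push_cast
      rw [smul_mul_assoc, mul_smul_comm, hu]
  exact this _ hmem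

/-- the columns of the graph projection -/
theorem graph_param (M : VonNeumannAlgebra H) (A : H →ₗ.[ℂ] H) (hd : Dense (A.domain : Set H))
    (hcl : IsClosed (A.graph : Set (H × H))) (haff : M.Affiliated A) :
    ∃ S ∈ M, ∃ C : H →L[ℂ] H, DenseRange S ∧ (∀ x, (S x, C x) ∈ A.graph) ∧
      ∀ p ∈ A.graph, p ∈ closure (Set.range fun x => (S x, C x)) := by
  let e : WithLp 2 (H × H) ≃L[ℂ] H × H := WithLp.prodContinuousLinearEquiv 2 ℂ H H
  let G : Submodule ℂ (WithLp 2 (H × H)) := A.graph.comap (e : WithLp 2 (H × H) →ₗ[ℂ] H × H)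
  have hG : ∀ w, w ∈ G ↔ (w.fst, w.snd) ∈ A.graph := fun w => Iff.rfl
  have hGc : IsClosed (G : Set (WithLp 2 (H × H))) := hcl.preimage e.continuous
  haveI : CompleteSpace G := hGc.completeSpace_coe
  let F : H →L[ℂ] WithLp 2 (H × H) :=
    G.starProjection ∘L (e.symm : H × H →L[ℂ] WithLp 2 (H × H)) ∘L ContinuousLinearMap.inl ℂ H H
  let S : H →L[ℂ] H := ContinuousLinearMap.fst ℂ H H ∘L (e : WithLp 2 (H × H) →L[ℂ] H × H) ∘L F
  let C : H →L[ℂ] H := ContinuousLinearMap.snd ℂ H H ∘L (e : WithLp 2 (H × H) →L[ℂ] H × H) ∘L F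
  have hF : ∀ x, F x = WithLp.toLp 2 (S x, C x) := fun x => rfl
  have hF' : ∀ x, F x = G.starProjection (WithLp.toLp 2 (x, 0)) := fun x => rfl
  have hmem : ∀ x, (S x, C x) ∈ A.graph := fun x =>
    (hG (F x)).1 (Submodule.starProjection_apply_mem _ _)
  have horth : ∀ x, ∀ p ∈ A.graph, inner ℂ (x - S x) p.1 + inner ℂ (- C x) p.2 = 0 := by
    intro x p hp
    have h1 : WithLp.toLp 2 (x, (0 : H)) - F x ∈ Gᗮ := Submodule.sub_starProjection_mem_orthogonal _
    have h2 := (Submodule.mem_orthogonal' _ _).1 h1 (WithLp.toLp 2 p) hp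
    rw [WithLp.prod_inner_apply] at h2
    simpa [hF, inner_sub_left] using h2
  have huniq : ∀ x u v, (u, v) ∈ A.graph →
      (∀ p ∈ A.graph, inner ℂ (x - u) p.1 + inner ℂ (- v) p.2 = 0) → S x = u := by
    intro x u v huv h
    have h1 : G.starProjection (WithLp.toLp 2 (x, 0)) = WithLp.toLp 2 (u, v) := by
      apply Submodule.eq_starProjection_of_mem_of_inner_eq_zero
      · exact huv
      · intro w hw
        rw [WithLp.prod_inner_apply]
        simpa [inner_sub_left] using h (w.fst, w.snd) hw
    have h2 := hF' x
    rw [h1] at h2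
    exact congrArg WithLp.fst h2
  have hdense : ∀ p ∈ A.graph, p ∈ closure (Set.range fun x => (S x, C x)) := by
    intro p hp
    let K : Submodule ℂ (WithLp 2 (H × H)) := F.range.topologicalClosure
    have hK : WithLp.toLp 2 p ∈ K := by
      haveI : CompleteSpace K := F.range.isClosed_topologicalClosure.completeSpace_coe
      let q := WithLp.toLp 2 p - K.starProjection (WithLp.toLp 2 p)
      have hqo : q ∈ Kᗮ := Submodule.sub_starProjection_mem_orthogonal _
      have hKG : K ≤ G := by
        apply Submodule.topologicalClosure_minimal _ _ hGc
        rintro _ ⟨x, rfl⟩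
        exact hmem x
      have hqG : q ∈ G := G.sub_mem hp (hKG (Submodule.starProjection_apply_mem _ _))
      have hq1 : q.fst = 0 := by
        have h1 := (Submodule.mem_orthogonal _ _).1 hqo (F q.fst)
          (Submodule.le_topologicalClosure _ ⟨q.fst, rfl⟩)
        rw [hF, WithLp.prod_inner_apply] at h1
        have h2 := horth q.fst (q.fst, q.snd) hqG
        simp only [inner_sub_left, inner_neg_left] at h2
        have h3 : inner ℂ q.fst q.fst = 0 := by
          have h1' : inner ℂ (S q.fst) q.fst + inner ℂ (C q.fst) q.snd = 0 := h1
          linear_combination h1' + h2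
        exact inner_self_eq_zero.1 h3
      have hq2 : q.snd = 0 := A.graph_fst_eq_zero_snd hqG hq1
      have hq0 : q = 0 := by
        have : q = WithLp.toLp 2 (q.fst, q.snd) := rfl
        rw [this, hq1, hq2]; rfl
      have : WithLp.toLp 2 p = K.starProjection (WithLp.toLp 2 p) := sub_eq_zero.1 hq0
      rw [this]
      exact Submodule.starProjection_apply_mem _ _
    have h5 : WithLp.toLp 2 p ∈ closure (Set.range F) := hK
    have h6 := image_closure_subset_closure_image e.continuous ⟨_, h5, rfl⟩
    rw [← Set.range_comp] at h6
    exact h6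
  refine ⟨S, ?_, C, ?_, hmem, hdense⟩
  · apply mem_of_commute_unitary
    intro U hU h1 h2
    ext x
    have hUG := haff U hU h1 h2
    have hin : ∀ v w, inner ℂ (U v) (U w) = inner ℂ v w := by
      intro v w
      rw [← ContinuousLinearMap.adjoint_inner_right, ← ContinuousLinearMap.star_eq_adjoint]
      have : (star U) (U w) = w := congrArg (fun f : H →L[ℂ] H => f w) h1
      rw [this]
    refine (huniq (U x) (U (S x)) (U (C x)) ?_ ?_).symm
    · have : (U (S x), U (C x)) ∈ (A.graph : Set (H × H)) := by
        rw [← hUG]; exact ⟨_, hmem x, rfl⟩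
      exact this
    · intro p hp
      have : p ∈ (A.graph : Set (H × H)) := hp
      rw [← hUG] at this
      obtain ⟨p', hp', rfl⟩ := this
      rw [← map_sub, ← map_neg, hin, hin]
      exact horth x p' hp'
  · intro y
    have h7 : (A.domain : Set H) ⊆ closure (Set.range S) := by
      intro z hz
      have h8 := hdense _ (A.mem_graph ⟨z, hz⟩)
      have h9 := image_closure_subset_closure_image continuous_fst ⟨_, h8, rfl⟩
      rw [← Set.range_comp] at h9
      exact h9
    exact closure_minimal h7 isClosed_closure (hd y)

end CoreAux

/-- If `A₁, …, Aₙ` are closed densely defined operators affiliated with a finite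
von Neumann algebra `M` (every isometry in `M` is a unitary), then
`D(A₁) ∩ ⋯ ∩ D(Aₙ)` is a core for each `Aᵢ`: the graph of `Aᵢ` is the closure of the graph
of the restriction of `Aᵢ` to this intersection. -/
theorem core_of_intersection_of_domains
    {H : Type*} [NormedAddCommGroup H] [InnerProductSpace ℂ H] [CompleteSpace H]
    (M : VonNeumannAlgebra H)
    (hfin : ∀ V : H →L[ℂ] H, V ∈ M → star V * V = 1 → V * star V = 1)
    (n : ℕ) (A : Fin n → (H →ₗ.[ℂ] H))
    (hdense : ∀ i, Dense ((A i).domain : Set H))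
    (hclosed : ∀ i, IsClosed ((A i).graph : Set (H × H)))
    (haff : ∀ i, M.Affiliated (A i)) (i : Fin n) :
    closure (((A i).domRestrict (⨅ j, (A j).domain)).graph : Set (H × H))
      = ((A i).graph : Set (H × H)) := by
  classical
  apply Set.Subset.antisymm
  · apply closure_minimal _ (hclosed i)
    exact LinearPMap.le_graph_of_le LinearPMap.domRestrict_le
  choose S hSM C hSd hmem hdns using fun j =>
    CoreAux.graph_param M (A j) (hdense j) (hclosed j) (haff j)
  obtain ⟨W, hWM, hWd, hW⟩ := CoreAux.inter M hfin S hSM hSd Finset.univ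
  obtain ⟨R, hRM, hRd, Q, hQ⟩ := CoreAux.ore M hfin (hSM i) hWM hWd
  intro p hp
  have h1 := hdns i p hp
  have hcont : Continuous fun x => (S i x, C i x) := (S i).continuous.prodMk (C i).continuous
  refine closure_minimal ?_ isClosed_closure h1
  rintro _ ⟨x, rfl⟩
  have h2 := image_closure_subset_closure_image hcont ⟨x, hRd x, rfl⟩
  refine closure_mono ?_ h2
  rintro _ ⟨_, ⟨z, rfl⟩, rfl⟩
  have hz : S i (R z) = W (Q z) := congrArg (fun f : H →L[ℂ] H => f z) hQ
  have hD : S i (R z) ∈ ⨅ j, (A j).domain := by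
    rw [Submodule.mem_iInf]
    intro j
    obtain ⟨y, hy⟩ := hW j (Finset.mem_univ j) (Q z)
    rw [hz, hy]
    exact LinearPMap.mem_domain_of_mem_graph (hmem j y)
  have hg := hmem i (R z)
  have hg2 := LinearPMap.mem_domain_of_mem_graph hg
  have h3 := LinearPMap.mem_graph ((A i).domRestrict (⨅ j, (A j).domain))
    ⟨S i (R z), hD, hg2⟩
  have h5 : (A i).domRestrict (⨅ j, (A j).domain) ⟨S i (R z), hD, hg2⟩ = A i ⟨S i (R z), hg2⟩ :=
    LinearPMap.domRestrict_apply rfl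
  rw [h5] at h3
  have h4 : C i (R z) = A i ⟨S i (R z), hg2⟩ :=
    LinearPMap.mem_graph_snd_inj _ hg ((A i).mem_graph ⟨S i (R z), hg2⟩) rfl
  simp only [h4]
  exact h3
end

section
/- Let M be a von Neumann algebra acting on a complex Hilbert space H, and let τ : M → ℂ be a positive, faithful, tracial linear functional. Let (H_α) be a net of positive operators in M and let A ∈ M be self-adjoint. If (H_α) converges to A in the measure topology (i.e., for every ε, δ > 0, eventually H_α − A ∈ O_τ(ε, δ)), then A is positive, i.e., 0 ≤ A. In other words, the positive cone M⁺ is closed in M^{sa} with respect to the measure topology. -/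
open scoped ComplexOrder

/-- The fundamental neighborhood `O_τ(ε, δ)` of `0` for the measure topology on a
von Neumann algebra `M` with positive tracial functional `τ`: those `A ∈ M` for which there is
a projection `E ∈ M` with `‖A E‖ ≤ ε` and `τ(1 - E) ≤ δ`. -/
def measureNbhd {H : Type*} [NormedAddCommGroup H] [InnerProductSpace ℂ H] [CompleteSpace H]
    (M : VonNeumannAlgebra H) (τ : (H →L[ℂ] H) →ₗ[ℂ] ℂ) (ε δ : ℝ) :
    Set (H →L[ℂ] H) :=
  {A | A ∈ M ∧ ∃ E : H →L[ℂ] H, E ∈ M ∧ IsIdempotentElem E ∧ IsSelfAdjoint E ∧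
    ‖A * E‖ ≤ ε ∧ τ (1 - E) ≤ (δ : ℂ)}

section aux
variable {H : Type*} [NormedAddCommGroup H] [InnerProductSpace ℂ H] [CompleteSpace H]

theorem aux_cfc_mem (M : VonNeumannAlgebra H) {A : H →L[ℂ] H} (hA : A ∈ M)
    (hs : IsSelfAdjoint A) (f : ℝ → ℝ) : cfc f A ∈ M := by
  rw [← VonNeumannAlgebra.commutant_commutant M, VonNeumannAlgebra.mem_commutant_iff]
  intro g hg
  have h : Commute A g := (VonNeumannAlgebra.mem_commutant_iff.1 hg) A hA
  exact (Commute.cfc_real h f).symm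

theorem aux_smul_mem (M : VonNeumannAlgebra H) {A : H →L[ℂ] H} (hA : A ∈ M) (r : ℂ) :
    r • A ∈ M := by
  have : r • A ∈ M.toStarSubalgebra := M.toStarSubalgebra.smul_mem hA r
  exact this

theorem aux_sqrt (M : VonNeumannAlgebra H) {A : H →L[ℂ] H} (hA : A ∈ M)
    (h : 0 ≤ A) : ∃ S ∈ M, A = star S * S := by
  have hs : IsSelfAdjoint A := .of_nonneg h
  refine ⟨cfc Real.sqrt A, aux_cfc_mem M hA hs _, ?_⟩
  have hk : IsSelfAdjoint (cfc Real.sqrt A) := cfc_predicate _ _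
  rw [hk.star_eq, ← cfc_mul Real.sqrt Real.sqrt A]
  conv_lhs => rw [← cfc_id ℝ A]
  refine cfc_congr fun x hx => ?_
  simp [Real.mul_self_sqrt (spectrum_nonneg_of_nonneg h hx)]

theorem aux_conj (M : VonNeumannAlgebra H) (τ : (H →L[ℂ] H) →ₗ[ℂ] ℂ)
    (hpos : ∀ a : H →L[ℂ] H, a ∈ M → 0 ≤ τ (star a * a))
    {P K : H →L[ℂ] H} (hP : P ∈ M) (hK : K ∈ M) (hs : IsSelfAdjoint K) (h : 0 ≤ P) :
    0 ≤ (τ (K * P * K)).re := by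
  obtain ⟨S, hS, rfl⟩ := aux_sqrt M hP h
  have := hpos (S * K) (mul_mem hS hK)
  rw [star_mul, hs.star_eq] at this
  have e : K * star S * (S * K) = K * (star S * S) * K := by simp only [mul_assoc]
  rw [e] at this
  exact (Complex.le_def.1 this).1

theorem aux_norm {A : H →L[ℂ] H} (hs : IsSelfAdjoint A) {c : ℝ} (hc : ‖A‖ ≤ c) :
    0 ≤ (c : ℂ) • (1 : H →L[ℂ] H) - A := by
  have h1 : A ≤ algebraMap ℝ _ ‖A‖ := hs.le_algebraMap_norm_self
  have h2 : algebraMap ℝ (H →L[ℂ] H) ‖A‖ ≤ algebraMap ℝ _ c := algebraMap_mono _ hc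
  have e : algebraMap ℝ (H →L[ℂ] H) c = (c : ℂ) • (1 : H →L[ℂ] H) := by
    rw [Algebra.algebraMap_eq_smul_one]; simp
  rw [sub_nonneg, ← e]
  exact h1.trans h2

theorem aux_op {A D E B : H →L[ℂ] H} (hA : IsSelfAdjoint A) (hE : IsIdempotentElem E)
    (hEs : IsSelfAdjoint E) (hD : D = star B * B - A) {s : ℝ} (hs : 0 < s) (hDE : ‖D * E‖ ≤ s) :
    0 ≤ A + (s : ℂ) • (A * A) + ((s⁻¹ + ‖A‖ : ℝ) : ℂ) • (1 - E) + (s : ℂ) • 1 := by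
  set F := 1 - E with hF
  have hFs : IsSelfAdjoint F := (IsSelfAdjoint.one _).sub hEs
  have hFF : F * F = F := hE.one_sub
  have hDs : IsSelfAdjoint D := by rw [hD]; exact (IsSelfAdjoint.star_mul_self B).sub hA
  have t1 : 0 ≤ star (B * E) * (B * E) := star_mul_self_nonneg _
  have hE1 : ‖E‖ ≤ 1 := IsStarProjection.norm_le E ⟨hE, hEs⟩
  have hEDE : ‖E * D * E‖ ≤ s := by
    rw [mul_assoc]
    calc _ ≤ ‖E‖ * ‖D * E‖ := norm_mul_le _ _
      _ ≤ 1 * s := by gcongr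
      _ = s := one_mul s
  have hEDEs : IsSelfAdjoint (E * D * E) := by
    have := hDs.conjugate E
    rwa [hEs.star_eq] at this
  have t2 := aux_norm hEDEs hEDE
  have t3 : 0 ≤ star F * ((‖A‖ : ℂ) • (1 : H →L[ℂ] H) - A) * F :=
    star_left_conjugate_nonneg (aux_norm hA le_rfl) F
  have t4 : 0 ≤ s • (star (A + ((s⁻¹ : ℝ) : ℂ) • F) * (A + ((s⁻¹ : ℝ) : ℂ) • F)) :=
    smul_nonneg hs.le (star_mul_self_nonneg _)
  have key := add_nonneg (add_nonneg (add_nonneg t1 t2) t3) t4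
  convert key using 1
  have e4 : s • (star (A + ((s⁻¹ : ℝ) : ℂ) • F) * (A + ((s⁻¹ : ℝ) : ℂ) • F))
      = (s : ℂ) • (A * A) + A * F + F * A + ((s⁻¹ : ℝ) : ℂ) • F := by
    have hs' : (s : ℂ) ≠ 0 := by exact_mod_cast hs.ne'
    rw [← Complex.coe_smul s, star_add, star_smul, hA.star_eq, hFs.star_eq]
    simp only [add_mul, mul_add, smul_mul_assoc, mul_smul_comm, hFF, smul_add, smul_smul]
    simp [hs']
    abel
  have e3 : star F * ((‖A‖ : ℂ) • (1 : H →L[ℂ] H) - A) * F = (‖A‖ : ℂ) • F - F * A * F := by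
    rw [hFs.star_eq]
    simp [mul_sub, sub_mul, hFF]
  have e1 : star (B * E) * (B * E) = E * (D + A) * E := by
    rw [star_mul, hEs.star_eq, hD]; simp [mul_assoc]
  have e0 : E = 1 - F := by simp [hF]
  have e5 : E * A * E = A - A * F - F * A + F * A * F := by
    rw [e0]; noncomm_ring
  rw [e1, e3, e4, mul_add, add_mul, e5, Complex.ofReal_add, add_smul]
  abel

end aux

/-- The positive cone of `M` is closed in the measure topology: if a net `(H_α)` of positive
elements of `M` converges in measure to a self-adjoint `A ∈ M`, then `A` is positive
(i.e. `A = B* B` for some `B ∈ M`). Here `τ` is a positive faithful tracial functional. -/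
theorem pos_of_tendsto_measure
    {H : Type*} [NormedAddCommGroup H] [InnerProductSpace ℂ H] [CompleteSpace H]
    {ι : Type*} [Preorder ι] [IsDirected ι (· ≤ ·)] [Nonempty ι]
    (M : VonNeumannAlgebra H) (τ : (H →L[ℂ] H) →ₗ[ℂ] ℂ)
    (hpos : ∀ a : H →L[ℂ] H, a ∈ M → 0 ≤ τ (star a * a))
    (hfaithful : ∀ a : H →L[ℂ] H, a ∈ M → τ (star a * a) = 0 → a = 0)
    (htrace : ∀ a ∈ M, ∀ b ∈ M, τ (a * b) = τ (b * a))
    (Hnet : ι → (H →L[ℂ] H))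
    (hH : ∀ α, ∃ B ∈ M, Hnet α = star B * B)
    (A : H →L[ℂ] H) (hAM : A ∈ M) (hAsa : IsSelfAdjoint A)
    (hconv : ∀ ε δ : ℝ, 0 < ε → 0 < δ →
      ∀ᶠ α in Filter.atTop, Hnet α - A ∈ measureNbhd M τ ε δ) :
    ∃ B ∈ M, A = star B * B := by
  classical
  set K := cfc (fun x : ℝ => Real.sqrt (max (-x) 0)) A with hKdef
  set B := cfc (fun x : ℝ => Real.sqrt (max x 0)) A with hBdef
  have hKM : K ∈ M := aux_cfc_mem M hAM hAsa _
  have hBM : B ∈ M := aux_cfc_mem M hAM hAsa _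
  have hKs : IsSelfAdjoint K := cfc_predicate _ _
  have hBs : IsSelfAdjoint B := cfc_predicate _ _
  have hAid : A = cfc (fun x : ℝ => x) A := (cfc_id' ℝ A).symm
  have hBK : A = B * B - K * K := by
    rw [hBdef, hKdef, ← cfc_mul .., ← cfc_mul .., ← cfc_sub ..]
    conv_lhs => rw [hAid]
    refine cfc_congr fun x _ => ?_
    simp only [Real.mul_self_sqrt (le_max_right _ (0 : ℝ))]
    rcases le_total 0 x with h | h
    · rw [max_eq_left h, max_eq_right (by linarith)]; ring
    · rw [max_eq_right h, max_eq_left (by linarith)]; ring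
  have hKAK : K * A * K = -((K * K) * (K * K)) := by
    have : K * A * K = K * cfc (fun x : ℝ => x) A * K := by rw [← hAid]
    rw [this, hKdef, ← cfc_mul .., ← cfc_mul .., ← cfc_mul .., ← cfc_mul .., ← cfc_neg ..]
    refine cfc_congr fun x _ => ?_
    simp only [Real.mul_self_sqrt (le_max_right _ (0 : ℝ))]
    rcases le_total 0 x with h | h
    · simp [max_eq_right (show -x ≤ 0 by linarith)]
    · rw [max_eq_left (show 0 ≤ -x by linarith)]
      have := Real.mul_self_sqrt (show 0 ≤ -x by linarith)
      linear_combination x * this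
  have hNM : K * K ∈ M := mul_mem hKM hKM
  have hNs : IsSelfAdjoint (K * K) := by
    have := IsSelfAdjoint.star_mul_self K
    rwa [hKs.star_eq] at this
  have hbound : ∀ s : ℝ, 0 < s → (τ ((K * K) * (K * K))).re ≤
      s * ((τ (K * (A * A) * K)).re + (1 + s * ‖A‖) * ‖K * K‖ + (τ (K * K)).re) := by
    intro s hs
    obtain ⟨α, hα⟩ := (hconv s (s ^ 2) hs (by positivity)).exists
    obtain ⟨-, E, hEM, hEi, hEs, hDE, hτE⟩ := hα
    obtain ⟨C, -, hC⟩ := hH α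
    have hP := aux_op hAsa hEi hEs (D := Hnet α - A) (B := C) (by rw [hC]) hs hDE
    have hFM : 1 - E ∈ M := sub_mem (one_mem M) hEM
    have hFs : IsSelfAdjoint (1 - E) := (IsSelfAdjoint.one _).sub hEs
    have hFF : (1 - E) * (1 - E) = 1 - E := hEi.one_sub
    have h1 := aux_conj M τ hpos (add_mem (add_mem (add_mem hAM
      (aux_smul_mem M (mul_mem hAM hAM) _)) (aux_smul_mem M hFM _))
      (aux_smul_mem M (one_mem M) _)) hKM hKs hP
    have h2 := aux_conj M τ hpos (sub_mem (aux_smul_mem M (one_mem M) _) hNM) hFM hFs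
      (aux_norm hNs le_rfl)
    have hδ : (τ (1 - E)).re ≤ s ^ 2 := by
      have := (Complex.le_def.1 hτE).1
      simpa only [Complex.ofReal_re] using this
    generalize hFdef : 1 - E = F at *
    have hcyc : τ (F * (K * K) * F) = τ (K * F * K) := by
      rw [htrace _ (mul_mem hFM hNM) _ hFM, ← mul_assoc, hFF, ← mul_assoc,
        htrace _ (mul_mem hFM hKM) _ hKM, mul_assoc]
    have h2' : (τ (K * F * K)).re ≤ ‖K * K‖ * (τ F).re := by
      rw [mul_sub, sub_mul, map_sub, hcyc, mul_smul_comm, mul_one, smul_mul_assoc, hFF,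
        map_smul, Complex.sub_re, smul_eq_mul, Complex.re_ofReal_mul] at h2
      linarith
    simp only [mul_add, add_mul, hKAK, mul_smul_comm, smul_mul_assoc, mul_one, map_add, map_neg,
      map_smul, smul_eq_mul, Complex.add_re, Complex.neg_re, Complex.re_ofReal_mul] at h1
    have h3 : (τ (K * F * K)).re ≤ ‖K * K‖ * s ^ 2 :=
      h2'.trans (mul_le_mul_of_nonneg_left hδ (norm_nonneg _))
    have h4 : (s⁻¹ + ‖A‖) * (τ (K * F * K)).re ≤ (s⁻¹ + ‖A‖) * (‖K * K‖ * s ^ 2) :=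
      mul_le_mul_of_nonneg_left h3 (by positivity)
    have h5 : (s⁻¹ + ‖A‖) * (‖K * K‖ * s ^ 2) = s * ((1 + s * ‖A‖) * ‖K * K‖) := by
      field_simp
    linarith
  have hle : (τ ((K * K) * (K * K))).re ≤ 0 := by
    have hc : Filter.Tendsto (fun s : ℝ =>
        s * ((τ (K * (A * A) * K)).re + (1 + s * ‖A‖) * ‖K * K‖ + (τ (K * K)).re))
        (nhdsWithin 0 (Set.Ioi 0)) (nhds 0) := by
      have : Continuous (fun s : ℝ =>
        s * ((τ (K * (A * A) * K)).re + (1 + s * ‖A‖) * ‖K * K‖ + (τ (K * K)).re)) := by fun_prop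
      have := (this.tendsto 0).mono_left (nhdsWithin_le_nhds (s := Set.Ioi 0))
      simpa only [zero_mul] using this
    exact ge_of_tendsto hc (by filter_upwards [self_mem_nhdsWithin] with s hs using hbound s hs)
  have hN0 : K * K = 0 := by
    apply hfaithful _ hNM
    have := hpos _ hNM
    rw [hNs.star_eq] at this ⊢
    obtain ⟨a, b⟩ := Complex.le_def.1 this
    exact Complex.ext (le_antisymm hle a) b.symm
  refine ⟨B, hBM, ?_⟩
  rw [hBs.star_eq]
  rw [hN0, sub_zero] at hBK
  exact hBK
end

section
/- Let M be a von Neumann algebra acting on a complex Hilbert space H, let τ : M → ℂ be a positive tracial linear functional with τ(1) = 1, and let n be a positive integer. Let A ∈ Mₙ(M) be an n×n matrix with entries A_{ij} ∈ M, and suppose that for each pair (i, j) there are ε_{ij}, δ_{ij} > 0 with A_{ij} ∈ O_τ(ε_{ij}, δ_{ij}). Then A ∈ O_{τₙ}(Σ_{i,j} ε_{ij}, Σ_{i,j} δ_{ij}), where the sums run over all 1 ≤ i, j ≤ n. -/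
open scoped ComplexOrder

/-- The bounded operator on `H^{⊕n}` (with its ℓ²-direct-sum norm) given by an `n × n` matrix of
bounded operators acting by matrix multiplication on column vectors.  The C*-norm on `Mₙ(M)` is
the operator norm of this operator. -/
noncomputable def Matrix.toCLM {H : Type*} [NormedAddCommGroup H] [InnerProductSpace ℂ H]
    (n : ℕ) (A : Matrix (Fin n) (Fin n) (H →L[ℂ] H)) :
    (PiLp 2 fun _ : Fin n => H) →L[ℂ] (PiLp 2 fun _ : Fin n => H) :=
  ((PiLp.continuousLinearEquiv 2 ℂ fun _ : Fin n => H).symm.toContinuousLinearMap).comp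
    ((ContinuousLinearMap.pi fun i => ∑ j, (A i j).comp
      ((ContinuousLinearMap.proj j).comp
        (PiLp.continuousLinearEquiv 2 ℂ fun _ : Fin n => H).toContinuousLinearMap)))

/-- The fundamental neighborhood `O_{τₙ}(ε, δ)` of `0` for the measure topology on the matrix
algebra `Mₙ(M)` with its normalized trace `τₙ(B) = (1/n) ∑ᵢ τ(Bᵢᵢ)`: those `A ∈ Mₙ(M)` for which
there is a projection `𝐄 ∈ Mₙ(M)` with `‖A 𝐄‖ ≤ ε` and `τₙ(𝐈ₙ − 𝐄) ≤ δ`. -/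
def measureNbhdMatrix {H : Type*} [NormedAddCommGroup H] [InnerProductSpace ℂ H]
    [CompleteSpace H] (M : VonNeumannAlgebra H) (τ : (H →L[ℂ] H) →ₗ[ℂ] ℂ) (n : ℕ) (ε δ : ℝ) :
    Set (Matrix (Fin n) (Fin n) (H →L[ℂ] H)) :=
  {A | (∀ i j, A i j ∈ M) ∧ ∃ E : Matrix (Fin n) (Fin n) (H →L[ℂ] H),
    (∀ i j, E i j ∈ M) ∧ E * E = E ∧ E.conjTranspose = E ∧ ‖Matrix.toCLM n (A * E)‖ ≤ ε ∧
    (1 / (n : ℂ)) * ∑ i, τ ((1 - E) i i) ≤ (δ : ℂ)}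

theorem polar_ext {H : Type*} [NormedAddCommGroup H] [InnerProductSpace ℂ H] [CompleteSpace H]
    (R : H →L[ℂ] H) (hR : IsSelfAdjoint R) :
    DenseRange (((R : H →ₗ[ℂ] H).coprod (LinearMap.ker (R : H →ₗ[ℂ] H)).subtype)) := by
  set e := ((R : H →ₗ[ℂ] H).coprod (LinearMap.ker (R : H →ₗ[ℂ] H)).subtype) with he
  have h : (LinearMap.range e)ᗮ = ⊥ := by
    rw [Submodule.eq_bot_iff]
    intro x hx
    rw [Submodule.mem_orthogonal] at hx
    have h1 : R x = 0 := by
      apply ext_inner_left ℂ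
      intro y
      have := hx (R y) ⟨(y, 0), by simp [he]⟩
      rw [inner_zero_right, ← this, ← ContinuousLinearMap.adjoint_inner_left]
      congr 1
      have h2 : ContinuousLinearMap.adjoint R = R := hR
      rw [h2]
    have := hx x ⟨(0, ⟨x, h1⟩), by simp [he]⟩
    simpa using this
  have h2 := (Submodule.topologicalClosure_eq_top_iff).mpr h
  have h3 := (Submodule.dense_iff_topologicalClosure_eq_top).mpr h2
  simpa [DenseRange] using! h3

theorem hilb_ext {H : Type*} [NormedAddCommGroup H] [InnerProductSpace ℂ H] [CompleteSpace H]
    (R : H →L[ℂ] H) (hR : IsSelfAdjoint R) (f g : H →L[ℂ] H)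
    (h1 : ∀ x, f (R x) = g (R x)) (h2 : ∀ x, R x = 0 → f x = g x) : f = g := by
  apply DFunLike.coe_injective
  apply (polar_ext R hR).equalizer f.continuous g.continuous
  funext ⟨x, k, hk⟩
  simp [h1, h2 k hk]

theorem exists_polar {H : Type*} [NormedAddCommGroup H] [InnerProductSpace ℂ H] [CompleteSpace H]
    (M : VonNeumannAlgebra H) (T : H →L[ℂ] H) (hT : T ∈ M) :
    ∃ v ∈ M, v * star v * v = v ∧ T * (star v * v) = T ∧ (∀ x, T x = 0 → v x = 0) ∧
      ∀ q : H →L[ℂ] H, q * T = T → q * v = v := by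
  obtain ⟨R, hR, hRR, hRc⟩ : ∃ R : H →L[ℂ] H, IsSelfAdjoint R ∧ R * R = star T * T ∧
      ∀ S, Commute S T → Commute S (star T) → Commute S R := by
    refine ⟨CFC.abs T, ?_, CFC.abs_mul_abs T, fun S h1 h2 => ?_⟩
    · exact (CFC.abs_nonneg T).isSelfAdjoint
    · exact Commute.cfcAbs_right h1.symm (by simpa using h2.star_star.symm)
  have hRa : ContinuousLinearMap.adjoint R = R := hR
  have hin : ∀ x y, inner ℂ (T x) (T y) = inner ℂ (R x) (R y) := by
    intro x y
    rw [← ContinuousLinearMap.adjoint_inner_right, ← ContinuousLinearMap.adjoint_inner_right R,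
      hRa]
    congr 1
    exact (congrArg (fun f : H →L[ℂ] H => f y) hRR).symm
  have hnorm : ∀ x, ‖T x‖ = ‖R x‖ := by
    intro x
    rw [@norm_eq_sqrt_re_inner ℂ, @norm_eq_sqrt_re_inner ℂ _ _ _ _ (R x), hin]
  have hTk : ∀ x, R x = 0 → T x = 0 := fun x hx => by
    rw [← norm_eq_zero, hnorm, hx, norm_zero]
  have hRk : ∀ x, T x = 0 → R x = 0 := fun x hx => by
    rw [← norm_eq_zero, ← hnorm, hx, norm_zero]
  set e := ((R : H →ₗ[ℂ] H).coprod (LinearMap.ker (R : H →ₗ[ℂ] H)).subtype) with he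
  set f : (H × LinearMap.ker (R : H →ₗ[ℂ] H)) →ₗ[ℂ] H :=
    (T : H →ₗ[ℂ] H).comp (LinearMap.fst ℂ _ _) with hf
  have hb : ∃ C, ∀ x, ‖f x‖ ≤ C * ‖e x‖ := by
    refine ⟨1, ?_⟩
    rintro ⟨x, k, hk⟩
    have hk' : R k = 0 := hk
    have h0 : inner ℂ (R x) k = 0 := by
      rw [← ContinuousLinearMap.adjoint_inner_right, hRa, hk', inner_zero_right]
    have := norm_add_sq_eq_norm_sq_add_norm_sq_of_inner_eq_zero (R x) k h0
    simp only [hf, he, LinearMap.comp_apply, LinearMap.fst_apply, LinearMap.coprod_apply,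
      ContinuousLinearMap.coe_coe, Submodule.subtype_apply, one_mul, hnorm]
    nlinarith [norm_nonneg (R x), norm_nonneg k, norm_nonneg (R x + k)]
  have hd : DenseRange e := polar_ext R hR
  set v := f.extendOfNorm e with hv
  have hvR : ∀ x, v (R x) = T x := by
    intro x
    have := LinearMap.extendOfNorm_eq hd hb (x, 0)
    simpa [he, hf] using this
  have hvk : ∀ x, R x = 0 → v x = 0 := by
    intro x hx
    have := LinearMap.extendOfNorm_eq hd hb (0, ⟨x, hx⟩)
    simpa [he, hf] using this
  have hTv : star T * v = R := by
    apply hilb_ext R hR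
    · intro x
      have := congrArg (fun f : H →L[ℂ] H => f x) hRR
      simpa [hvR] using this.symm
    · intro x hx
      simp [hvk x hx, hx]
  have hvT : ∀ x, star v (T x) = R x := by
    intro x
    have := congrArg star hTv
    rw [star_mul, star_star, hR.star_eq] at this
    exact congrArg (fun f : H →L[ℂ] H => f x) this
  refine ⟨v, ?_, ?_, ?_, fun x hx => hvk x (hRk x hx), ?_⟩
  · rw [← VonNeumannAlgebra.commutant_commutant M, VonNeumannAlgebra.mem_commutant_iff]
    intro S hS
    rw [VonNeumannAlgebra.mem_commutant_iff] at hS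
    have h1 := hS T hT
    have hc : Commute S R := hRc S (hS T hT).symm (hS _ (star_mem hT)).symm
    have hc' : ∀ x, S (R x) = R (S x) := fun x => congrArg (fun f : H →L[ℂ] H => f x) hc.eq
    apply hilb_ext R hR
    · intro x
      have := congrArg (fun f : H →L[ℂ] H => f x) h1
      simpa [hvR, hc'] using this.symm
    · intro x hx
      have : R (S x) = 0 := by rw [← hc', hx, map_zero]
      simp [hvk x hx, hvk _ this]
  · apply hilb_ext R hR
    · intro x
      simp [hvR, hvT]
    · intro x hx
      simp [hvk x hx]
  · apply hilb_ext R hR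
    · intro x
      simp [hvR, hvT]
    · intro x hx
      simp [hvk x hx, hTk x hx]
  · intro q hq
    apply hilb_ext R hR
    · intro x
      have := congrArg (fun f : H →L[ℂ] H => f x) hq
      simpa [hvR] using this
    · intro x hx
      simp [hvk x hx]

theorem exists_inf {H : Type*} [NormedAddCommGroup H] [InnerProductSpace ℂ H] [CompleteSpace H]
    (M : VonNeumannAlgebra H) (τ : (H →L[ℂ] H) →ₗ[ℂ] ℂ)
    (hpos : ∀ a : H →L[ℂ] H, a ∈ M → 0 ≤ τ (star a * a))
    (htrace : ∀ a ∈ M, ∀ b ∈ M, τ (a * b) = τ (b * a))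
    (E F : H →L[ℂ] H) (hE : E ∈ M) (hF : F ∈ M) (hEi : E * E = E) (hFi : F * F = F)
    (hEs : star E = E) (hFs : star F = F) :
    ∃ G ∈ M, G * G = G ∧ star G = G ∧ E * G = G ∧ F * G = G ∧
      τ (1 - G) ≤ τ (1 - E) + τ (1 - F) := by
  obtain ⟨v, hv, hvv, hTv, hker, hq⟩ := exists_polar M ((1 - F) * E)
    (mul_mem (sub_mem (one_mem M) hF) hE)
  have hvE : v * (1 - E) = 0 := by
    ext x
    apply hker
    have : ((1 - F) * E) * (1 - E) = 0 := by
      rw [mul_assoc, mul_sub, mul_one, hEi, sub_self, mul_zero]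
    exact congrArg (fun f : H →L[ℂ] H => f x) this
  have hvE' : v * E = v := by
    rw [mul_sub, mul_one, sub_eq_zero] at hvE; exact hvE.symm
  have hEv : E * star v = star v := by
    have := congrArg star hvE'
    rwa [star_mul, hEs] at this
  have hFv : F * v = 0 := by
    have := hq (1 - F) (by rw [← mul_assoc, sub_mul, one_mul, mul_sub, mul_one, hFi]; simp)
    rw [sub_mul, one_mul] at this
    simpa using this
  have hvF : star v * F = 0 := by
    have := congrArg star hFv
    rwa [star_mul, hFs, star_zero] at this
  set p := star v * v with hp
  have hpp : p * p = p := by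
    rw [hp, mul_assoc, ← mul_assoc v, hvv]
  have hps : star p = p := by simp [hp]
  have hEp : E * p = p := by rw [hp, ← mul_assoc, hEv]
  have hpE : p * E = p := by rw [hp, mul_assoc, hvE']
  have hpM : p ∈ M := mul_mem (star_mem hv) hv
  refine ⟨E - p, sub_mem hE hpM, ?_, ?_, ?_, ?_, ?_⟩
  · rw [sub_mul, mul_sub, mul_sub, hEi, hEp, hpE, hpp]; simp
  · rw [star_sub, hEs, hps]
  · rw [mul_sub, hEi, hEp]
  · have : (1 - F) * (E - p) = 0 := by
      rw [← hEp, mul_sub, ← mul_assoc, hTv, sub_self]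
    rw [sub_mul, one_mul, sub_eq_zero] at this
    exact this.symm
  · have h1 : (1 : H →L[ℂ] H) - (E - p) = (1 - E) + p := by abel
    rw [h1, map_add]
    gcongr
    rw [hp, htrace _ (star_mem hv) _ hv]
    set w := (1 - F) - v * star v with hw
    have hvs : v * star v * (v * star v) = v * star v := by rw [← mul_assoc, hvv]
    have hww : star w * w = w := by
      have hs : star w = w := by simp [hw, hFs]
      have a1 : F * (v * star v) = 0 := by rw [← mul_assoc, hFv, zero_mul]
      have a2 : v * star v * F = 0 := by rw [mul_assoc, hvF, mul_zero]
      rw [hs, hw]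
      simp only [sub_mul, mul_sub, one_mul, mul_one, hvs, a1, a2, hFi]
      abel
    have := hpos w (sub_mem (sub_mem (one_mem M) hF) (mul_mem hv (star_mem hv)))
    rw [hww, hw, map_sub] at this
    exact sub_nonneg.mp this

theorem exists_finset_inf {H : Type*} [NormedAddCommGroup H] [InnerProductSpace ℂ H]
    [CompleteSpace H]
    (M : VonNeumannAlgebra H) (τ : (H →L[ℂ] H) →ₗ[ℂ] ℂ)
    (hpos : ∀ a : H →L[ℂ] H, a ∈ M → 0 ≤ τ (star a * a))
    (htrace : ∀ a ∈ M, ∀ b ∈ M, τ (a * b) = τ (b * a))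
    {ι : Type*} (E : ι → H →L[ℂ] H) (hE : ∀ i, E i ∈ M) (hEi : ∀ i, E i * E i = E i)
    (hEs : ∀ i, star (E i) = E i) (s : Finset ι) :
    ∃ G ∈ M, G * G = G ∧ star G = G ∧ (∀ i ∈ s, E i * G = G) ∧
      τ (1 - G) ≤ ∑ i ∈ s, τ (1 - E i) := by
  classical
  induction s using Finset.induction_on with
  | empty => exact ⟨1, one_mem M, by simp, by simp, by simp, by simp⟩
  | insert a s ha ih =>
    obtain ⟨G, hG, hGi, hGs, hEG, hτ⟩ := ih
    obtain ⟨K, hK, hKi, hKs, h1, h2, h3⟩ := exists_inf M τ hpos htrace (E a) G (hE a) hG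
      (hEi a) hGi (hEs a) hGs
    refine ⟨K, hK, hKi, hKs, ?_, ?_⟩
    · intro i hi
      rcases Finset.mem_insert.mp hi with rfl | hi
      · exact h1
      · rw [← h2, ← mul_assoc, hEG i hi]
    · rw [Finset.sum_insert ha]
      exact h3.trans (by gcongr)

theorem norm_toCLM_le {H : Type*} [NormedAddCommGroup H] [InnerProductSpace ℂ H]
    (n : ℕ) (B : Matrix (Fin n) (Fin n) (H →L[ℂ] H)) :
    ‖Matrix.toCLM n B‖ ≤ ∑ i, ∑ j, ‖B i j‖ := by
  apply ContinuousLinearMap.opNorm_le_bound _ (by positivity)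
  intro x
  have hc : ∀ i, (Matrix.toCLM n B x) i = ∑ j, B i j (x j) := by
    intro i
    simp [Matrix.toCLM]
  have h1 : ∀ i, ‖(Matrix.toCLM n B x) i‖ ≤ (∑ j, ‖B i j‖) * ‖x‖ := by
    intro i
    rw [hc, Finset.sum_mul]
    refine (norm_sum_le _ _).trans (Finset.sum_le_sum fun j _ => ?_)
    refine ((B i j).le_opNorm _).trans ?_
    gcongr
    exact PiLp.norm_apply_le x j
  rw [PiLp.norm_eq_of_L2, Finset.sum_mul]
  apply Real.sqrt_le_iff.mpr
  refine ⟨by positivity, ?_⟩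
  refine (Finset.sum_le_sum fun i _ => pow_le_pow_left₀ (norm_nonneg _) (h1 i) 2).trans ?_
  exact Finset.sum_sq_le_sq_sum_of_nonneg (fun i _ => by positivity)

/-- If every entry of the matrix `A ∈ Mₙ(M)` satisfies `A_{ij} ∈ O_τ(ε_{ij}, δ_{ij})`, then
`A ∈ O_{τₙ}(∑_{i,j} ε_{ij}, ∑_{i,j} δ_{ij})`. -/
theorem matrix_mem_measureNbhd_of_entries
    {H : Type*} [NormedAddCommGroup H] [InnerProductSpace ℂ H] [CompleteSpace H]
    (M : VonNeumannAlgebra H) (τ : (H →L[ℂ] H) →ₗ[ℂ] ℂ)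
    (hpos : ∀ a : H →L[ℂ] H, a ∈ M → 0 ≤ τ (star a * a))
    (htrace : ∀ a ∈ M, ∀ b ∈ M, τ (a * b) = τ (b * a))
    (hone : τ 1 = 1)
    (n : ℕ) (hn : 0 < n)
    (A : Matrix (Fin n) (Fin n) (H →L[ℂ] H)) (hA : ∀ i j, A i j ∈ M)
    (ε δ : Fin n → Fin n → ℝ) (hε : ∀ i j, 0 < ε i j) (hδ : ∀ i j, 0 < δ i j)
    (hmem : ∀ i j, A i j ∈ measureNbhd M τ (ε i j) (δ i j)) :
    A ∈ measureNbhdMatrix M τ n (∑ i, ∑ j, ε i j) (∑ i, ∑ j, δ i j) := by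
  choose hAM E hEM hEi hEs hEn hEτ using hmem
  have key := fun j => exists_finset_inf M τ hpos htrace (fun i => E i j) (fun i => hEM i j)
    (fun i => hEi i j) (fun i => hEs i j) Finset.univ
  choose G hG hGi hGs hEG hGτ using key
  refine ⟨hA, Matrix.diagonal G, ?_, ?_, ?_, ?_, ?_⟩
  · intro i j
    rw [Matrix.diagonal_apply]
    split_ifs
    · exact hG i
    · exact zero_mem M
  · rw [Matrix.diagonal_mul_diagonal]
    simp only [hGi]
  · rw [Matrix.diagonal_conjTranspose]
    congr 1
    funext i
    exact hGs i
  · refine (norm_toCLM_le n _).trans (Finset.sum_le_sum fun i _ => Finset.sum_le_sum fun j _ => ?_)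
    rw [Matrix.mul_diagonal, ← hEG j i (Finset.mem_univ i), ← mul_assoc]
    have hG1 : ‖G j‖ ≤ 1 := by
      have h := CStarRing.norm_star_mul_self (x := G j)
      rw [hGs, hGi] at h
      by_contra hlt
      nlinarith
    calc ‖A i j * E i j * G j‖ ≤ ‖A i j * E i j‖ * ‖G j‖ := norm_mul_le _ _
      _ ≤ ‖A i j * E i j‖ * 1 := by gcongr
      _ ≤ ε i j := by rw [mul_one]; exact hEn i j
  · have h1 : ∑ i, τ ((1 - Matrix.diagonal G) i i) ≤ ((∑ i, ∑ j, δ i j : ℝ) : ℂ) := by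
      rw [Finset.sum_comm]
      push_cast
      refine Finset.sum_le_sum fun j _ => ?_
      simp only [Matrix.sub_apply, Matrix.one_apply_eq, Matrix.diagonal_apply_eq]
      exact (hGτ j).trans (Finset.sum_le_sum fun i _ => hEτ i j)
    have hn1 : (1 : ℝ) ≤ n := by exact_mod_cast hn
    have h0 : 0 ≤ ∑ i, ∑ j, δ i j :=
      Finset.sum_nonneg fun i _ => Finset.sum_nonneg fun j _ => (hδ i j).le
    have hc : (0 : ℂ) ≤ 1 / (n : ℂ) := by
      have : (0 : ℝ) ≤ 1 / (n : ℝ) := by positivity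
      simpa using Complex.zero_le_real.mpr this
    refine (mul_le_mul_of_nonneg_left h1 hc).trans ?_
    have h2 : 1 / (n : ℝ) * (∑ i, ∑ j, δ i j) ≤ ∑ i, ∑ j, δ i j := by
      apply mul_le_of_le_one_left h0
      rw [div_le_one (by linarith)]
      exact hn1
    have h3 := Complex.real_le_real.mpr h2
    simpa using h3
end

section
/- Let M be a von Neumann algebra acting on a complex Hilbert space H, let τ : M → ℂ be a positive tracial linear functional with τ(1) = 1, and let n be a positive integer. Let ε > 0 and 0 < δ < 1/(16n). If A ∈ Mₙ(M) satisfies A ∈ O_{τₙ}(ε, δ), then every entry satisfies A_{ij} ∈ O_τ(2ε, √(4nδ)) for 1 ≤ i, j ≤ n. -/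
open scoped ComplexOrder

section Helpers

variable {H : Type*} [NormedAddCommGroup H] [InnerProductSpace ℂ H] [CompleteSpace H]

/-- Douglas-type factorization through a self-adjoint operator. -/
theorem aux_factor (c : H →L[ℂ] H) (hc : IsSelfAdjoint c) :
    ∃ R : H →L[ℂ] H, IsIdempotentElem R ∧ IsSelfAdjoint R ∧ R * c = c ∧
      (∀ X : H →L[ℂ] H, X * c = 0 → X * R = 0) ∧
      (∀ b : H →L[ℂ] H, (∀ x, ‖b x‖ ≤ ‖c x‖) → ∃ w : H →L[ℂ] H, w * c = b ∧ w * R = w) := by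
  let K : Submodule ℂ H := (LinearMap.range (c : H →ₗ[ℂ] H)).topologicalClosure
  have : CompleteSpace K :=
    (Submodule.isClosed_topologicalClosure _).completeSpace_coe
  have hmem : ∀ x, c x ∈ K := fun x =>
    Submodule.le_topologicalClosure _ ⟨x, rfl⟩
  have hidem : IsIdempotentElem K.starProjection := K.isIdempotentElem_starProjection
  have hRc : K.starProjection * c = c := by
    ext x
    exact Submodule.starProjection_eq_self_iff.2 (hmem x)
  refine ⟨K.starProjection, hidem, ?_, hRc, ?_, ?_⟩
  · exact isSelfAdjoint_starProjection K
  · intro X hX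
    ext y
    have hy : K.starProjection y ∈ K := Submodule.starProjection_apply_mem K y
    have hle : K ≤ LinearMap.ker (X : H →ₗ[ℂ] H) := by
      apply Submodule.topologicalClosure_minimal
      · rintro _ ⟨x, rfl⟩
        exact congrArg (fun T : H →L[ℂ] H => T x) hX
      · exact X.isClosed_ker
    exact hle hy
  · intro b hb
    let e : H →ₗ[ℂ] K := (c : H →ₗ[ℂ] H).codRestrict K hmem
    have hd : DenseRange e := by
      intro y
      rw [Metric.mem_closure_iff]
      intro r hr
      have hy : (y : H) ∈ closure (LinearMap.range (c : H →ₗ[ℂ] H) : Set H) := y.2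
      obtain ⟨_, ⟨x, rfl⟩, hx⟩ := Metric.mem_closure_iff.1 hy r hr
      exact ⟨e x, ⟨x, rfl⟩, hx⟩
    have hn : ∃ C, ∀ x, ‖(b : H →ₗ[ℂ] H) x‖ ≤ C * ‖e x‖ := ⟨1, fun x => by
      rw [one_mul]; exact hb x⟩
    let v : K →L[ℂ] H := (b : H →ₗ[ℂ] H).extendOfNorm e
    have hv : ∀ x, v (e x) = b x := fun x => LinearMap.extendOfNorm_eq hd hn x
    have key : ∀ x : H, K.orthogonalProjectionOnto (K.starProjection x)
        = K.orthogonalProjectionOnto x := by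
      intro x
      apply Subtype.ext
      exact congrArg (fun T : H →L[ℂ] H => T x) hidem
    refine ⟨v ∘L K.orthogonalProjectionOnto, ?_, ?_⟩
    · ext x
      have : K.orthogonalProjectionOnto (c x) = e x := by
        apply Subtype.ext
        exact congrArg (fun T : H →L[ℂ] H => T x) hRc
      change v (K.orthogonalProjectionOnto (c x)) = b x
      rw [this, hv]
    · ext x
      change v (K.orthogonalProjectionOnto (K.starProjection x)) = v (K.orthogonalProjectionOnto x)
      rw [key]

theorem aux_polar (M : VonNeumannAlgebra H) {n : ℕ} (b : Fin n → (H →L[ℂ] H))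
    (hb : ∀ k, b k ∈ M) :
    ∃ (c R : H →L[ℂ] H) (w : Fin n → (H →L[ℂ] H)), R * R = R ∧ star R = R ∧ c * R = c ∧
      (∀ X : H →L[ℂ] H, X * c = 0 → X * R = 0) ∧
      (∀ k, w k * c = b k) ∧ (∀ k, w k * R = w k) ∧ (∀ k, w k ∈ M) ∧
      ∑ k, star (w k) * w k = R := by
  set a : H →L[ℂ] H := ∑ k, star (b k) * b k with ha
  have ha0 : 0 ≤ a := Finset.sum_nonneg fun k _ => star_mul_self_nonneg (b k)
  set c := CFC.sqrt a with hcdef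
  have hcc : c * c = a := CFC.sqrt_mul_sqrt_self a ha0
  have hc : IsSelfAdjoint c := (CFC.sqrt_nonneg a).isSelfAdjoint
  obtain ⟨R, hR, hRs, hRc, hX, hw⟩ := aux_factor c hc
  have hcR : c * R = c := by
    have := congrArg star hRc
    rwa [star_mul, hc.star_eq, hRs.star_eq] at this
  have hnorm : ∀ x, ∑ k, ‖b k x‖ ^ 2 = ‖c x‖ ^ 2 := by
    intro x
    have h1 : ∀ T : H →L[ℂ] H, ((‖T x‖ ^ 2 : ℝ) : ℂ) = inner ℂ ((star T * T) x) x := by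
      intro T
      rw [mul_apply_eq_comp, ContinuousLinearMap.star_eq_adjoint,
        ContinuousLinearMap.adjoint_inner_left, inner_self_eq_norm_sq_to_K]
      push_cast
      rfl
    have h2 : ((∑ k, ‖b k x‖ ^ 2 : ℝ) : ℂ) = ((‖c x‖ ^ 2 : ℝ) : ℂ) := by
      rw [Complex.ofReal_sum, h1 c, hc.star_eq, hcc, ha, sum_apply, sum_inner]
      exact Finset.sum_congr rfl fun k _ => h1 (b k)
    exact_mod_cast h2
  have hle : ∀ k x, ‖b k x‖ ≤ ‖c x‖ := by
    intro k x
    have h1 : ‖b k x‖ ^ 2 ≤ ‖c x‖ ^ 2 := by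
      rw [← hnorm x]
      exact Finset.single_le_sum (f := fun k => ‖b k x‖ ^ 2) (fun _ _ => by positivity)
        (Finset.mem_univ k)
    exact (sq_le_sq₀ (norm_nonneg _) (norm_nonneg _)).1 h1
  choose w hwc hwR using fun k => hw (b k) (hle k)
  have hext : ∀ X Y : H →L[ℂ] H, X * c = Y * c → X * R = Y * R := by
    intro X Y h
    have := hX (X - Y) (by rw [sub_mul, h, sub_self])
    rwa [sub_mul, sub_eq_zero] at this
  have haM : a ∈ M := sum_mem fun k _ => mul_mem (star_mem (hb k)) (hb k)
  refine ⟨c, R, w, hR, hRs, hcR, hX, hwc, hwR, ?_, ?_⟩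
  · intro k
    have hRu' : ∀ u ∈ M.commutant, R * u * R = u * R := by
      intro u hu
      have hua : Commute a u := VonNeumannAlgebra.mem_commutant_iff.1 hu a haM
      have huc : c * u = u * c := (hua.cfcₙ_nnreal NNReal.sqrt).eq
      exact hext _ _ (by rw [mul_assoc, ← huc, ← mul_assoc, hRc])
    rw [← VonNeumannAlgebra.commutant_commutant M, VonNeumannAlgebra.mem_commutant_iff]
    intro u hu
    have hua : Commute a u := VonNeumannAlgebra.mem_commutant_iff.1 hu a haM
    have huc : c * u = u * c := (hua.cfcₙ_nnreal NNReal.sqrt).eq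
    have hub : b k * u = u * b k := VonNeumannAlgebra.mem_commutant_iff.1 hu _ (hb k)
    have h1 := hRu' u hu
    have h2 := congrArg star (hRu' (star u) (star_mem hu))
    simp only [star_mul, star_star, hRs.star_eq] at h2
    have hRu : u * R = R * u := by rw [← h1, mul_assoc, h2]
    have h3 := hext (u * w k) (w k * u) (by
      rw [mul_assoc, hwc, mul_assoc, ← huc, ← mul_assoc, hwc, hub])
    rw [mul_assoc, hwR, mul_assoc, hRu, ← mul_assoc, hwR] at h3
    exact h3
  · set Q := ∑ k, star (w k) * w k with hQ
    have hQR : Q * R = Q := by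
      rw [hQ, Finset.sum_mul]
      exact Finset.sum_congr rfl fun k _ => by rw [mul_assoc, hwR]
    have hQs : star Q = Q := by
      rw [hQ, star_sum]
      exact Finset.sum_congr rfl fun k _ => by rw [star_mul, star_star]
    have h1 : c * Q * c = c * c := by
      rw [hcc, ha, hQ, Finset.mul_sum, Finset.sum_mul]
      refine Finset.sum_congr rfl fun k _ => ?_
      rw [← hwc k, star_mul, hc.star_eq]
      simp only [mul_assoc]
    have h2 := hext _ _ h1
    rw [mul_assoc, hQR, hcR] at h2
    have h3 := congrArg star h2
    rw [star_mul, hQs, hc.star_eq] at h3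
    have h4 := hext Q 1 (by rw [h3, one_mul])
    rwa [hQR, one_mul] at h4

theorem aux_entry_norm (n : ℕ) (B : Matrix (Fin n) (Fin n) (H →L[ℂ] H)) (i j : Fin n) :
    ‖B i j‖ ≤ ‖Matrix.toCLM n B‖ := by
  refine ContinuousLinearMap.opNorm_le_bound _ (norm_nonneg _) fun x => ?_
  have h1 : (Matrix.toCLM n B (PiLp.single 2 j x)) i = B i j x := by
    simp [Matrix.toCLM, Pi.single_apply, apply_ite]
  calc ‖B i j x‖ = ‖(Matrix.toCLM n B (PiLp.single 2 j x)) i‖ := by rw [h1]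
    _ ≤ ‖Matrix.toCLM n B (PiLp.single 2 j x)‖ := PiLp.norm_apply_le _ _
    _ ≤ ‖Matrix.toCLM n B‖ * ‖(PiLp.single 2 j x : PiLp 2 fun _ : Fin n => H)‖ :=
      ContinuousLinearMap.le_opNorm _ _
    _ = ‖Matrix.toCLM n B‖ * ‖x‖ := by simp

end Helpers

/-- If `A ∈ Mₙ(M)` lies in `O_{τₙ}(ε, δ)` with `0 < δ < 1/(16n)`, then every entry satisfies
`A_{ij} ∈ O_τ(2ε, √(4nδ))`. -/
theorem entries_mem_measureNbhd_of_matrix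
    {H : Type*} [NormedAddCommGroup H] [InnerProductSpace ℂ H] [CompleteSpace H]
    (M : VonNeumannAlgebra H) (τ : (H →L[ℂ] H) →ₗ[ℂ] ℂ)
    (hpos : ∀ a : H →L[ℂ] H, a ∈ M → 0 ≤ τ (star a * a))
    (htrace : ∀ a ∈ M, ∀ b ∈ M, τ (a * b) = τ (b * a))
    (hone : τ 1 = 1)
    (n : ℕ) (hn : 0 < n)
    (ε δ : ℝ) (hε : 0 < ε) (hδ : 0 < δ) (hδ' : δ < 1 / (16 * n))
    (A : Matrix (Fin n) (Fin n) (H →L[ℂ] H))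
    (hA : A ∈ measureNbhdMatrix M τ n ε δ) :
    ∀ i j, A i j ∈ measureNbhd M τ (2 * ε) (Real.sqrt (4 * n * δ)) := by
  obtain ⟨hAM, E, hEM, hEE, hEs, hnorm, htr⟩ := hA
  intro i j
  set F : Matrix (Fin n) (Fin n) (H →L[ℂ] H) := 1 - E with hF
  have hFF : F * F = F := by
    rw [hF, sub_mul, one_mul, mul_sub, mul_one, hEE, sub_self, sub_zero]
  have hFs : F.conjTranspose = F := by
    rw [hF, Matrix.conjTranspose_sub, hEs, Matrix.conjTranspose_one]
  have hFs' : ∀ k l, star (F k l) = F l k := fun k l => by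
    conv_rhs => rw [← hFs]
    rfl
  have hFF' : ∀ k l, ∑ m, F k m * F m l = F k l := fun k l => by
    conv_rhs => rw [← hFF, Matrix.mul_apply]
  have hFM : ∀ k l, F k l ∈ M := by
    intro k l
    rw [hF, Matrix.sub_apply]
    refine sub_mem ?_ (hEM k l)
    rw [Matrix.one_apply]
    split_ifs
    · exact one_mem M
    · exact zero_mem M
  obtain ⟨c, R, w, hRR, hRs, hcR, hX, hwc, hwR, hwM, hwsum⟩ :=
    aux_polar M (fun k => F k j) (fun k => hFM k j)
  have hRM : R ∈ M := by
    rw [← hwsum]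
    exact sum_mem fun k _ => mul_mem (star_mem (hwM k)) (hwM k)
  have hFw : ∀ k, ∑ l, F k l * w l = w k := by
    intro k
    have h := hX (∑ l, F k l * w l - w k) (by
      rw [sub_mul, hwc, Finset.sum_mul, sub_eq_zero]
      simp only [mul_assoc, hwc]
      exact hFF' k j)
    rw [sub_mul, hwR, Finset.sum_mul, sub_eq_zero] at h
    simpa only [mul_assoc, hwR] using h
  have hwF : ∀ k, ∑ l, star (w l) * F l k = star (w k) := by
    intro k
    have h := congrArg star (hFw k)
    simpa only [star_sum, star_mul, hFs'] using h
  have hG : ∀ k, ∑ l, star (F l k - w l * star (w k)) * (F l k - w l * star (w k))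
      = F k k - w k * star (w k) := by
    intro k
    have h1 : ∀ l, star (F l k - w l * star (w k)) * (F l k - w l * star (w k))
        = F k l * F l k - F k l * w l * star (w k) - w k * (star (w l) * F l k)
          + w k * (star (w l) * w l) * star (w k) := by
      intro l
      rw [star_sub, star_mul, star_star, hFs']
      noncomm_ring
    simp only [h1]
    rw [Finset.sum_add_distrib, Finset.sum_sub_distrib, Finset.sum_sub_distrib, hFF',
      ← Finset.sum_mul, hFw, ← Finset.mul_sum, hwF, ← Finset.sum_mul, ← Finset.mul_sum,
      hwsum, hwR]
    abel
  have hle : ∀ k, τ (star (w k) * w k) ≤ τ (F k k) := by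
    intro k
    rw [htrace _ (star_mem (hwM k)) _ (hwM k), ← sub_nonneg, ← map_sub, ← hG k, map_sum]
    exact Finset.sum_nonneg fun l _ =>
      hpos _ (sub_mem (hFM l k) (mul_mem (hwM l) (star_mem (hwM k))))
  have hnpos : (0 : ℝ) < n := by exact_mod_cast hn
  have hτR : τ R ≤ ((n * δ : ℝ) : ℂ) := by
    have h1 : τ R ≤ ∑ k, τ (F k k) := by
      rw [← hwsum, map_sum]
      exact Finset.sum_le_sum fun k _ => hle k
    have h2 : ∑ k, τ (F k k) ≤ ((n * δ : ℝ) : ℂ) := by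
      have hnc : (0 : ℂ) ≤ (n : ℂ) := by exact_mod_cast hnpos.le
      have hn0 : (n : ℂ) ≠ 0 := by exact_mod_cast hn.ne'
      have h3 := mul_le_mul_of_nonneg_left htr hnc
      rw [← mul_assoc, mul_one_div_cancel hn0, one_mul] at h3
      push_cast
      exact h3
    exact h1.trans h2
  have hnd : n * δ ≤ Real.sqrt (4 * n * δ) := by
    have h0 : 0 < n * δ := by positivity
    have h1 : n * δ < 1 / 16 := by
      rw [lt_div_iff₀ (by positivity)] at hδ' ⊢
      linarith
    apply Real.le_sqrt_of_sq_le
    nlinarith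
  refine ⟨hAM i j, 1 - R, sub_mem (one_mem M) hRM, ?_, ?_, ?_, ?_⟩
  · exact IsIdempotentElem.one_sub hRR
  · exact (IsSelfAdjoint.one _).sub hRs
  · have hcP : c * (1 - R) = 0 := by rw [mul_sub, mul_one, hcR, sub_self]
    have hFP : ∀ k, F k j * (1 - R) = 0 := fun k => by
      rw [← hwc k, mul_assoc, hcP, mul_zero]
    have hAF : (A * F) i j * (1 - R) = 0 := by
      rw [Matrix.mul_apply, Finset.sum_mul]
      exact Finset.sum_eq_zero fun k _ => by rw [mul_assoc, hFP, mul_zero]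
    have hAE : A i j = (A * E) i j + (A * F) i j := by
      rw [← Matrix.add_apply, ← mul_add, hF, add_sub_cancel, mul_one]
    have hP1 : ‖1 - R‖ ≤ 1 :=
      IsStarProjection.norm_le (1 - R) ⟨IsIdempotentElem.one_sub hRR, (IsSelfAdjoint.one _).sub hRs⟩
    rw [hAE, add_mul, hAF, add_zero]
    calc ‖(A * E) i j * (1 - R)‖ ≤ ‖(A * E) i j‖ * ‖1 - R‖ := norm_mul_le _ _
      _ ≤ ‖(A * E) i j‖ * 1 := by gcongr
      _ ≤ ε := by rw [mul_one]; exact (aux_entry_norm n _ i j).trans hnorm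
      _ ≤ 2 * ε := by linarith
  · rw [sub_sub_cancel]
    exact hτR.trans (by exact_mod_cast hnd)
end
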